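/- arXiv:2206.03047 — 3 statements merged into one kernel-verified Lean document; each statement's English description precedes it below -/
import Mathlib

section
/- Let n ≥ 0 and 0 < k < F_{n+2}. Write the Zeckendorf expansions of k−1 and of k padded with leading 0s to digits in positions 2 through n+1, say k−1 = [u_{n+1}⋯u_2]_F and k = [v_{n+1}⋯v_2]_F, and let j be the largest index with u_j ≠ v_j. Then the k-th move of the optimal solution of the Tower of Hanoi-Fibonacci with n disks is a (j−1)-Fibonacci move. -/
/-- A `k`-Fibonacci move on states of the Tower of Hanoi-Fibonacci with `n` disks.
Disks are numbered `1,…,n`; disk `k` corresponds to index `i : Fin n` with `(i : ℕ) + 1 = k`.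
Pegs are `Fin 3` (`0 = A`, `1 = B`, `2 = C`). -/
def FibMove (n k : ℕ) (s s' : Fin n → Fin 3) : Prop :=
  1 ≤ k ∧ k ≤ n ∧
  ∃ X Y Z : Fin 3, X ≠ Y ∧ Y ≠ Z ∧ X ≠ Z ∧
    (∀ i : Fin n, (i : ℕ) + 1 = k → s i = X) ∧
    (∀ i : Fin n, (i : ℕ) + 1 < k → s i ≠ X) ∧
    (∀ i : Fin n, (i : ℕ) + 1 < k → s i = Y) ∧
    (∀ i : Fin n, ((i : ℕ) + 1 = k ∨ (i : ℕ) + 2 = k) → s' i = Z) ∧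
    (∀ i : Fin n, (i : ℕ) + 1 ≠ k → (i : ℕ) + 2 ≠ k → s' i = s i)

/-- `s 0, s 1, …, s m` is a solution of length `m` of the Tower of Hanoi-Fibonacci
with `n` disks: it starts with all disks on peg `A = 0`, ends with all disks on
peg `C = 2`, and each step is a Fibonacci move. -/
def IsSolution (n m : ℕ) (s : ℕ → (Fin n → Fin 3)) : Prop :=
  (s 0 = fun _ => 0) ∧ (s m = fun _ => 2) ∧ ∀ i < m, ∃ k, FibMove n k (s i) (s (i + 1))

/-- `FibPath n l s t`: the Fibonacci moves with indices listed in `l` lead from `s` to `t`. -/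
inductive FibPath (n : ℕ) : List ℕ → (Fin n → Fin 3) → (Fin n → Fin 3) → Prop
  | nil (s : Fin n → Fin 3) : FibPath n [] s s
  | cons {k : ℕ} {l : List ℕ} {s r t : Fin n → Fin 3} :
      FibMove n k s r → FibPath n l r t → FibPath n (k :: l) s t

/-- The disks `1, …, m` all lie on peg `X`. -/
def Gathered {n : ℕ} (m : ℕ) (X : Fin 3) (s : Fin n → Fin 3) : Prop :=
  ∀ i : Fin n, (i : ℕ) + 1 ≤ m → s i = X

/-- Disk `m` lies on peg `Z` and the disks `1, …, m - 1` lie on peg `Y`. -/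
def Separated {n : ℕ} (m : ℕ) (Y Z : Fin 3) (s : Fin n → Fin 3) : Prop :=
  (∀ i : Fin n, (i : ℕ) + 1 = m → s i = Z) ∧ ∀ i : Fin n, (i : ℕ) + 1 < m → s i = Y

/-- The move indices of the optimal solution: `optimalMoves (n + 1)` solves `n` disks. -/
def optimalMoves : ℕ → List ℕ
  | 0 => []
  | 1 => []
  | n + 2 => optimalMoves (n + 1) ++ (n + 1) :: optimalMoves n

theorem length_optimalMoves_add_one : ∀ n, (optimalMoves n).length + 1 = Nat.fib (n + 1)
  | 0 => rfl
  | 1 => rfl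
  | n + 2 => by
    have h₀ := length_optimalMoves_add_one n
    have h₁ := length_optimalMoves_add_one (n + 1)
    have h₂ := Nat.fib_add_two (n := n + 1)
    simp only [optimalMoves, List.length_append, List.length_cons]
    simp only [add_assoc, Nat.reduceAdd] at *
    omega

theorem fibPath_append {n : ℕ} {l₁ l₂ : List ℕ} {s t : Fin n → Fin 3} :
    FibPath n (l₁ ++ l₂) s t ↔ ∃ r, FibPath n l₁ s r ∧ FibPath n l₂ r t := by
  induction l₁ generalizing s with
  | nil =>
    refine ⟨fun h => ⟨s, .nil s, h⟩, ?_⟩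
    rintro ⟨r, h₁, h₂⟩
    cases h₁
    exact h₂
  | cons k l ih =>
    constructor
    · intro h
      cases h with
      | cons hm hp =>
        obtain ⟨q, h₁, h₂⟩ := ih.1 hp
        exact ⟨q, .cons hm h₁, h₂⟩
    · rintro ⟨r, h₁, h₂⟩
      cases h₁ with
      | cons hm hp => exact .cons hm (ih.2 ⟨r, hp, h₂⟩)

theorem FibPath.exists_of_append_cons {n k : ℕ} {l₁ l₂ : List ℕ} {s t : Fin n → Fin 3}
    (h : FibPath n (l₁ ++ k :: l₂) s t) :
    ∃ a b, FibPath n l₁ s a ∧ FibMove n k a b ∧ FibPath n l₂ b t := by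
  obtain ⟨a, h₁, h₂⟩ := fibPath_append.1 h
  cases h₂ with
  | cons hm hp => exact ⟨a, _, h₁, hm, hp⟩

/-- Moves with index at most `m` do not affect the disks larger than `m`. -/
theorem FibPath.apply_eq {n m : ℕ} {l : List ℕ} {s t : Fin n → Fin 3} (h : FibPath n l s t)
    (hl : ∀ k ∈ l, k ≤ m) (i : Fin n) (hi : m < (i : ℕ) + 1) : t i = s i := by
  induction h with
  | nil s => rfl
  | cons hm hp ih =>
    obtain ⟨_, _, X, Y, Z, _, _, _, _, _, _, _, hfix⟩ := hm
    have hk := hl _ List.mem_cons_self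
    rw [ih fun k hk => hl k (List.mem_cons_of_mem _ hk)]
    exact hfix i (by omega) (by omega)

theorem FibMove.separated {n p : ℕ} {s r : Fin n → Fin 3} (h : FibMove n (p + 1) s r) :
    ∃ X Y Z, X ≠ Y ∧ Y ≠ Z ∧ X ≠ Z ∧ Separated (p + 1) Y X s ∧ Separated p Y Z r ∧
      ∀ i : Fin n, (i : ℕ) = p → r i = Z := by
  obtain ⟨_, _, X, Y, Z, hXY, hYZ, hXZ, hX, _, hY, hZ, hfix⟩ := h
  refine ⟨X, Y, Z, hXY, hYZ, hXZ, ⟨hX, hY⟩, ⟨fun i hi => hZ i (by omega), fun i hi => ?_⟩,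
    fun i hi => hZ i (by omega)⟩
  rw [hfix i (by omega) (by omega)]
  exact hY i (by omega)

theorem Separated.gathered {n p : ℕ} {Y Z : Fin 3} {s : Fin n → Fin 3}
    (h : Separated (p + 1) Y Z s) : Gathered p Y s :=
  fun i hi => h.2 i (by omega)

theorem forall_le_of_notMem {p : ℕ} {l : List ℕ} (hl : ∀ k ∈ l, k ≤ p + 1) (h : p + 1 ∉ l) :
    ∀ k ∈ l, k ≤ p := by
  intro k hk
  have h₁ := hl k hk
  have h₂ : k ≠ p + 1 := fun e => h (e ▸ hk)
  omega

theorem List.exists_append_cons_notMem_right {a : ℕ} {l : List ℕ} (h : a ∈ l) :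
    ∃ l₁ l₂, l = l₁ ++ a :: l₂ ∧ a ∉ l₂ := by
  obtain ⟨l₁, l₂, e, h'⟩ := List.eq_append_cons_of_mem (List.mem_reverse.2 h)
  exact ⟨l₂.reverse, l₁.reverse, by simpa using congrArg List.reverse e, by simpa using h'⟩

/-- Moving a tower of `m` disks to another peg by moves of index at most `m` takes at least
`fib (m + 2) - 1` moves, with equality only for `optimalMoves (m + 1)`. -/
def TowerBound (n m : ℕ) : Prop :=
  ∀ (l : List ℕ) (s t : Fin n → Fin 3) (X Z : Fin 3), X ≠ Z → FibPath n l s t →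
    (∀ k ∈ l, k ≤ m) → Gathered m X s → Gathered m Z t →
    Nat.fib (m + 2) ≤ l.length + 1 ∧ (l.length + 1 = Nat.fib (m + 2) → l = optimalMoves (m + 1))

/-- Gathering `m` disks on the peg of disk `m`, when the others are together on another peg, takes
at least `fib (m + 1) - 1` moves, with equality only for `optimalMoves m`. -/
def JoinBound (n m : ℕ) : Prop :=
  ∀ (l : List ℕ) (s t : Fin n → Fin 3) (Y Z : Fin 3), Y ≠ Z → FibPath n l s t →
    (∀ k ∈ l, k ≤ m) → Separated m Y Z s → Gathered m Z t →
    Nat.fib (m + 1) ≤ l.length + 1 ∧ (l.length + 1 = Nat.fib (m + 1) → l = optimalMoves m)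

/-- Gathering `m` disks off the peg of disk `m`, when the others are together on another peg, takes
at least `fib m` moves. -/
def LeaveBound (n m : ℕ) : Prop :=
  ∀ (l : List ℕ) (s t : Fin n → Fin 3) (Y Z W : Fin 3), Y ≠ Z → W ≠ Z → FibPath n l s t →
    (∀ k ∈ l, k ≤ m) → Separated m Y Z s → Gathered m W t → Nat.fib m ≤ l.length

/-- The join that follows a move of the largest disk. -/
theorem JoinBound.after_move {n p : ℕ} (hG : JoinBound n p) (hp : p < n) {l : List ℕ}
    {a b t : Fin n → Fin 3} {W : Fin 3} (hm : FibMove n (p + 1) a b) (hl : FibPath n l b t)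
    (hle : ∀ k ∈ l, k ≤ p) (ht : Gathered (p + 1) W t) :
    Nat.fib (p + 1) ≤ l.length + 1 ∧ (l.length + 1 = Nat.fib (p + 1) → l = optimalMoves p) := by
  obtain ⟨X, Y, Z, -, hYZ, -, -, hb, hZ⟩ := hm.separated
  have hfix := hl.apply_eq hle ⟨p, hp⟩ (Nat.lt_succ_self p)
  rw [hZ ⟨p, hp⟩ rfl, ht ⟨p, hp⟩ le_rfl] at hfix
  subst hfix
  exact hG l b t Y W hYZ hl hle hb fun i hi => ht i (by omega)

theorem JoinBound.fib_le_length {n p : ℕ} (hG : JoinBound n p) (hp : p < n) {l : List ℕ}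
    {s t : Fin n → Fin 3} {W : Fin 3} (hl : FibPath n l s t) (hle : ∀ k ∈ l, k ≤ p + 1)
    (hmem : p + 1 ∈ l) (ht : Gathered (p + 1) W t) : Nat.fib (p + 1) ≤ l.length := by
  obtain ⟨l₁, l₂, rfl, hn⟩ := List.exists_append_cons_notMem_right hmem
  obtain ⟨a, b, -, hm, h₂⟩ := hl.exists_of_append_cons
  have h := (hG.after_move hp hm h₂
    (forall_le_of_notMem (fun k hk => hle k (by simp [hk])) hn) ht).1
  simp only [List.length_append, List.length_cons]
  omega

theorem leaveBound_succ {n p : ℕ} (hp : p < n) (hG : JoinBound n p) : LeaveBound n (p + 1) := by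
  intro l s t Y Z W _ hWZ hl hle hs ht
  refine hG.fib_le_length hp hl hle ?_ ht
  by_contra hn
  have hfix := hl.apply_eq (forall_le_of_notMem hle hn) ⟨p, hp⟩ (Nat.lt_succ_self p)
  rw [hs.1 ⟨p, hp⟩ rfl, ht ⟨p, hp⟩ le_rfl] at hfix
  exact hWZ hfix

theorem towerBound_succ {n p : ℕ} (hp : p < n) (hL : TowerBound n p) (hG : JoinBound n p) :
    TowerBound n (p + 1) := by
  intro l s t X Z hXZ hl hle hs ht
  have hmem : p + 1 ∈ l := by
    by_contra hn
    have hfix := hl.apply_eq (forall_le_of_notMem hle hn) ⟨p, hp⟩ (Nat.lt_succ_self p)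
    rw [hs ⟨p, hp⟩ le_rfl, ht ⟨p, hp⟩ le_rfl] at hfix
    exact hXZ hfix.symm
  obtain ⟨l₁, l₂, rfl, hn⟩ := List.eq_append_cons_of_mem hmem
  obtain ⟨a, b, h₁, hm, h₂⟩ := hl.exists_of_append_cons
  have hle₁ := forall_le_of_notMem (fun k hk => hle k (by simp [hk])) hn
  have hle₂ : ∀ k ∈ l₂, k ≤ p + 1 := fun k hk => hle k (by simp [hk])
  obtain ⟨X', Y, Z', hXY, -, -, ha, -, -⟩ := hm.separated
  have hfix := h₁.apply_eq hle₁ ⟨p, hp⟩ (Nat.lt_succ_self p)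
  rw [ha.1 ⟨p, hp⟩ rfl, hs ⟨p, hp⟩ le_rfl] at hfix
  subst hfix
  obtain ⟨hlen₁, heq₁⟩ :=
    hL l₁ s a _ Y hXY h₁ hle₁ (fun i hi => hs i (by omega)) ha.gathered
  have hfib : Nat.fib (p + 1 + 2) = Nat.fib (p + 1) + Nat.fib (p + 2) := Nat.fib_add_two
  simp only [List.length_append, List.length_cons]
  by_cases hmem₂ : p + 1 ∈ l₂
  · have := hG.fib_le_length hp h₂ hle₂ hmem₂ ht
    exact ⟨by omega, fun h => by omega⟩
  · obtain ⟨hlen₂, heq₂⟩ := hG.after_move hp hm h₂ (forall_le_of_notMem hle₂ hmem₂) ht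
    refine ⟨by omega, fun h => ?_⟩
    rw [heq₁ (by omega), heq₂ (by omega), optimalMoves]

theorem joinBound_succ {n p : ℕ} (hp : p < n) (hL : TowerBound n p) (hG : JoinBound n p)
    (hH : LeaveBound n p) : JoinBound n (p + 1) := by
  intro l s t Y Z hYZ hl hle hs ht
  by_cases hmem : p + 1 ∈ l
  swap
  · exact hL l s t Y Z hYZ hl (forall_le_of_notMem hle hmem) hs.gathered
      fun i hi => ht i (by omega)
  obtain ⟨l₁, l₂, rfl, hn⟩ := List.eq_append_cons_of_mem hmem
  obtain ⟨a, b, h₁, hm, h₂⟩ := hl.exists_of_append_cons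
  have hle₁ := forall_le_of_notMem (fun k hk => hle k (by simp [hk])) hn
  have hle₂ : ∀ k ∈ l₂, k ≤ p + 1 := fun k hk => hle k (by simp [hk])
  obtain ⟨X, Y', Z', -, hYZ', hXZ, ha, hb, hZ'⟩ := hm.separated
  have hfix := h₁.apply_eq hle₁ ⟨p, hp⟩ (Nat.lt_succ_self p)
  rw [ha.1 ⟨p, hp⟩ rfl, hs.1 ⟨p, hp⟩ rfl] at hfix
  subst hfix
  have hmem₂ : p + 1 ∈ l₂ := by
    by_contra hn₂
    have hfix := h₂.apply_eq (forall_le_of_notMem hle₂ hn₂) ⟨p, hp⟩ (Nat.lt_succ_self p)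
    rw [hZ' ⟨p, hp⟩ rfl, ht ⟨p, hp⟩ le_rfl] at hfix
    exact hXZ hfix
  obtain ⟨l₃, l₄, rfl, hn₃⟩ := List.eq_append_cons_of_mem hmem₂
  obtain ⟨c, d, h₃, hm', h₄⟩ := h₂.exists_of_append_cons
  have hle₃ := forall_le_of_notMem (fun k hk => hle₂ k (by simp [hk])) hn₃
  obtain ⟨X'', Y'', Z'', hXY'', -, -, hc, -, -⟩ := hm'.separated
  have hfix := h₃.apply_eq hle₃ ⟨p, hp⟩ (Nat.lt_succ_self p)
  rw [hc.1 ⟨p, hp⟩ rfl, hZ' ⟨p, hp⟩ rfl] at hfix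
  subst hfix
  have hlen₃ := hH l₃ b c Y' _ Y'' hYZ' hXY''.symm h₃ hle₃ hb hc.gathered
  have hlen₄ := hG.fib_le_length hp (FibPath.cons hm' h₄)
    (fun k hk => hle₂ k (List.mem_append_right _ hk)) List.mem_cons_self ht
  have hfib : Nat.fib (p + 1 + 1) = Nat.fib p + Nat.fib (p + 1) := Nat.fib_add_two
  simp only [List.length_append, List.length_cons] at hlen₄ ⊢
  exact ⟨by omega, fun h => by omega⟩

theorem tower_join_leave_bounds {n m : ℕ} (hm : m ≤ n) :
    TowerBound n m ∧ JoinBound n m ∧ LeaveBound n m := by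
  induction m with
  | zero =>
    refine ⟨fun l _ _ _ _ _ _ _ _ _ => ⟨?_, fun h => ?_⟩,
      fun l _ _ _ _ _ _ _ _ _ => ⟨?_, fun h => ?_⟩, fun l _ _ _ _ _ _ _ _ _ _ _ => ?_⟩
    · simp
    · simpa [optimalMoves] using h
    · simp
    · simpa [optimalMoves] using h
    · simp
  | succ p ih =>
    obtain ⟨hL, hG, hH⟩ := ih (by omega)
    exact ⟨towerBound_succ hm hL hG, joinBound_succ hm hL hG hH, leaveBound_succ hm hG⟩

theorem fibPath_map_range {n m : ℕ} {s : ℕ → Fin n → Fin 3} {κ : ℕ → ℕ}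
    (h : ∀ i < m, FibMove n (κ i) (s i) (s (i + 1))) :
    FibPath n ((List.range m).map κ) (s 0) (s m) := by
  induction m with
  | zero => exact .nil _
  | succ m ih =>
    rw [List.range_succ, List.map_append]
    exact fibPath_append.2 ⟨s m, ih fun i hi => h i (by omega), .cons (h m (by omega)) (.nil _)⟩

/-- The moves of a solution of length `fib (n + 2) - 1` are `optimalMoves (n + 1)`. -/
theorem IsSolution.fibMove_of_getElem? {n i k : ℕ} {s : ℕ → Fin n → Fin 3}
    (hs : IsSolution n (Nat.fib (n + 2) - 1) s) (hk : (optimalMoves (n + 1))[i]? = some k) :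
    FibMove n k (s i) (s (i + 1)) := by
  obtain ⟨h₀, h₁, hstep⟩ := hs
  have hpos : 0 < Nat.fib (n + 2) := Nat.fib_pos.2 (by omega)
  have hex : ∀ i, ∃ k, i < Nat.fib (n + 2) - 1 → FibMove n k (s i) (s (i + 1)) := fun i => by
    by_cases hi : i < Nat.fib (n + 2) - 1
    · exact (hstep i hi).imp fun _ h _ => h
    · exact ⟨0, fun h => absurd h hi⟩
  choose κ hκ using hex
  have hopt := ((tower_join_leave_bounds le_rfl).1 _ _ _ 0 2 (by decide) (fibPath_map_range hκ)
    (by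
      simp only [List.mem_map, List.mem_range]
      rintro k ⟨i, hi, rfl⟩
      exact (hκ i hi).2.1)
    (fun i _ => by rw [h₀]) (fun i _ => by rw [h₁])).2
    (by rw [List.length_map, List.length_range]; omega)
  rw [← hopt] at hk
  obtain ⟨hi, hk⟩ := List.getElem?_eq_some_iff.1 hk
  rw [List.length_map, List.length_range] at hi
  simp only [List.getElem_map, List.getElem_range] at hk
  exact hk ▸ hκ i hi

/-- A sum of non-consecutive Fibonacci numbers with indices in `2, …, m` is less than
`fib (m + 1)`. -/
theorem sum_digits_mul_fib_lt {u : ℕ → ℕ} (hu01 : ∀ i, u i ≤ 1)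
    (hu11 : ∀ i, ¬(u i = 1 ∧ u (i + 1) = 1)) (hu1 : u 1 = 0) :
    ∀ m, ∑ i ∈ Finset.range (m + 1), u i * Nat.fib i < Nat.fib (m + 1)
  | 0 => by simp
  | 1 => by simp [Finset.sum_range_succ, hu1]
  | m + 2 => by
    have h₀ := sum_digits_mul_fib_lt hu01 hu11 hu1 m
    have h₁ := sum_digits_mul_fib_lt hu01 hu11 hu1 (m + 1)
    have hfib : Nat.fib (m + 2 + 1) = Nat.fib (m + 1) + Nat.fib (m + 2) := Nat.fib_add_two
    rw [Finset.sum_range_succ]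
    rcases Nat.le_one_iff_eq_zero_or_eq_one.1 (hu01 (m + 2)) with h | h
    · rw [h]
      simp only [add_assoc, Nat.reduceAdd] at *
      omega
    · have h' : u (m + 1) = 0 := by
        have h₂ := hu01 (m + 1)
        have h₃ := hu11 (m + 1)
        simp only [add_assoc, Nat.reduceAdd] at h₃
        omega
      rw [Finset.sum_range_succ, h, h']
      omega

theorem getElem?_optimalMoves {u v : ℕ → ℕ} (hu01 : ∀ i, u i ≤ 1)
    (hu11 : ∀ i, ¬(u i = 1 ∧ u (i + 1) = 1)) (hu1 : u 1 = 0) (hv01 : ∀ i, v i ≤ 1)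
    (hv11 : ∀ i, ¬(v i = 1 ∧ v (i + 1) = 1)) (hv1 : v 1 = 0) {j : ℕ} (hj : u j ≠ v j) :
    ∀ m k, ∑ i ∈ Finset.range (m + 1), u i * Nat.fib i = k →
      ∑ i ∈ Finset.range (m + 1), v i * Nat.fib i = k + 1 → j ≤ m →
      (∀ i, j < i → i ≤ m → u i = v i) → (optimalMoves m)[k]? = some (j - 1)
  | 0 => by simp
  | 1 => by simp [Finset.sum_range_succ, hv1]
  | m + 2 => by
    intro k hu hv hjm hjmax
    have hu_lt := sum_digits_mul_fib_lt hu01 hu11 hu1 (m + 1)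
    have hv_lt := sum_digits_mul_fib_lt hv01 hv11 hv1 (m + 1)
    have hlen := length_optimalMoves_add_one (m + 1)
    have hu_le := hu01 (m + 2)
    have hv_le := hv01 (m + 2)
    rw [Finset.sum_range_succ] at hu hv
    rw [optimalMoves]
    rcases eq_or_lt_of_le hjm with rfl | hjlt
    · have huv : u (m + 2) = 0 ∧ v (m + 2) = 1 ∨ u (m + 2) = 1 ∧ v (m + 2) = 0 := by omega
      rcases huv with ⟨hu0, hv0⟩ | ⟨hu0, hv0⟩
      · rw [hu0] at hu
        rw [hv0] at hv
        simp only [add_assoc, Nat.reduceAdd] at *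
        have hk : k = (optimalMoves (m + 1)).length := by omega
        simp [hk]
      · rw [hu0] at hu
        rw [hv0] at hv
        simp only [add_assoc, Nat.reduceAdd] at *
        omega
    · have huv := hjmax (m + 2) hjlt le_rfl
      rcases Nat.le_one_iff_eq_zero_or_eq_one.1 hu_le with h | h
      · rw [h] at hu
        rw [← huv, h] at hv
        simp only [zero_mul, add_zero] at hu hv
        rw [List.getElem?_append_left (by
          simp only [add_assoc, Nat.reduceAdd] at *
          omega)]
        exact getElem?_optimalMoves hu01 hu11 hu1 hv01 hv11 hv1 hj (m + 1) k hu hv (by omega)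
          fun i h₁ h₂ => hjmax i h₁ (by omega)
      · have hu₁ := hu01 (m + 1)
        have hu₂ := hu11 (m + 1)
        have hv₁ := hv01 (m + 1)
        have hv₂ := hv11 (m + 1)
        simp only [add_assoc, Nat.reduceAdd] at hu₂ hv₂
        have hu₀ : u (m + 1) = 0 := by omega
        have hv₀ : v (m + 1) = 0 := by omega
        have hjne : j ≠ m + 1 := by
          rintro rfl
          exact hj (hu₀.trans hv₀.symm)
        rw [Finset.sum_range_succ, h, hu₀] at hu
        rw [Finset.sum_range_succ, ← huv, h, hv₀] at hv
        simp only [zero_mul, add_zero, one_mul] at hu hv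
        have ih := getElem?_optimalMoves hu01 hu11 hu1 hv01 hv11 hv1 hj m
          (k - Nat.fib (m + 2)) (by omega) (by omega) (by omega)
          fun i h₁ h₂ => hjmax i h₁ (by omega)
        simp only [add_assoc, Nat.reduceAdd] at *
        rw [List.getElem?_append_right (by omega)]
        have hk : k - (optimalMoves (m + 1)).length = k - Nat.fib (m + 2) + 1 := by omega
        rw [hk, List.getElem?_cons_succ, ih]

/-- Let `n ≥ 0` and `0 < k < F (n+2)`. If `u` and `v` are the digit
sequences (padded with leading zeros to positions `2,…,n+1`) of the Zeckendorf
expansions of `k - 1` and `k` respectively, and `j` is the largest index with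
`u j ≠ v j`, then the `k`-th move of the optimal solution of the Tower of
Hanoi-Fibonacci with `n` disks is a `(j-1)`-Fibonacci move. -/
theorem hanoiFibonacci_kth_move_zeckendorf (n k : ℕ) (hk0 : 0 < k)
    (hk : k < Nat.fib (n + 2))
    (u v : ℕ → ℕ)
    (hu01 : ∀ i, u i ≤ 1) (hu11 : ∀ i, ¬(u i = 1 ∧ u (i + 1) = 1))
    (husupp : ∀ i, i < 2 ∨ n + 1 < i → u i = 0)
    (husum : ∑ i ∈ Finset.range (n + 2), u i * Nat.fib i = k - 1)
    (hv01 : ∀ i, v i ≤ 1) (hv11 : ∀ i, ¬(v i = 1 ∧ v (i + 1) = 1))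
    (hvsupp : ∀ i, i < 2 ∨ n + 1 < i → v i = 0)
    (hvsum : ∑ i ∈ Finset.range (n + 2), v i * Nat.fib i = k)
    (j : ℕ) (hj : u j ≠ v j) (hjmax : ∀ i, j < i → u i = v i)
    (s : ℕ → (Fin n → Fin 3)) (hs : IsSolution n (Nat.fib (n + 2) - 1) s) :
    FibMove n (j - 1) (s (k - 1)) (s k) := by

  have hjle : j ≤ n + 1 := by
    by_contra h
    exact hj ((husupp j (by omega)).trans (hvsupp j (by omega)).symm)
  have h := getElem?_optimalMoves hu01 hu11 (husupp 1 (by omega)) hv01 hv11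
    (hvsupp 1 (by omega)) hj (n + 1) (k - 1) husum
    (by rw [hvsum]; omega) hjle fun i hi _ => hjmax i hi
  have hmove := hs.fibMove_of_getElem? h
  rwa [Nat.sub_add_cancel hk0] at hmove
end

section
/- Let p ≥ 1 and q ≥ 0 be integers. For every n ≥ 0, the (p,q)-Tower of Hanoi with n disks admits a solution, there is exactly one solution of minimal length, and this minimal length is m_n, where the sequence (m_j)_{j ∈ ℤ} is defined by m_j = 0 for j ≤ 0 and m_j = m_{j−p} + m_{j−p−q} + 1 for j > 0. -/
/-- A `(p,q)`-move on states of the `(p,q)`-Tower of Hanoi with `n` disks.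
Disks are numbered `1,…,n` (disk `k` corresponds to `i : Fin n` with `(i : ℕ) + 1 = k`)
and pegs are `Fin 3` (`0 = A`, `1 = B`, `2 = C`).  For some `1 ≤ k ≤ n` and pairwise
distinct pegs `X, Y, Z`: in `s`, every disk in `{max(1, k-p+1), …, k}` lies on `X`, no
disk smaller than `k-p+1` lies on `X`, every disk in `{1, …, k-p}` lies on `Y`, and
`s'` agrees with `s` except that every disk in `{max(1, k-p+1-q), …, k}` now lies on
`Z`. -/
def PQMove (p q n k : ℕ) (s s' : Fin n → Fin 3) : Prop :=
  1 ≤ k ∧ k ≤ n ∧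
  ∃ X Y Z : Fin 3, X ≠ Y ∧ Y ≠ Z ∧ X ≠ Z ∧
    (∀ i : Fin n, k - p < (i : ℕ) + 1 → (i : ℕ) + 1 ≤ k → s i = X) ∧
    (∀ i : Fin n, (i : ℕ) + 1 ≤ k - p → s i ≠ X) ∧
    (∀ i : Fin n, (i : ℕ) + 1 ≤ k - p → s i = Y) ∧
    (∀ i : Fin n, k - p - q < (i : ℕ) + 1 → (i : ℕ) + 1 ≤ k → s' i = Z) ∧
    (∀ i : Fin n, (i : ℕ) + 1 ≤ k - p - q ∨ k < (i : ℕ) + 1 → s' i = s i)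

/-- `s 0, s 1, …, s m` is a solution of length `m` of the `(p,q)`-Tower of Hanoi with
`n` disks. -/
def IsPQSolution (p q n m : ℕ) (s : ℕ → (Fin n → Fin 3)) : Prop :=
  (s 0 = fun _ => 0) ∧ (s m = fun _ => 2) ∧ ∀ i < m, ∃ k, PQMove p q n k (s i) (s (i + 1))

namespace PQHanoi

variable {p q n : ℕ}

/-- `PQMove` with disks numbered from `0`. -/
theorem pqMove_iff {k : ℕ} {s s' : Fin n → Fin 3} :
    PQMove p q n k s s' ↔ 1 ≤ k ∧ k ≤ n ∧ ∃ X Y Z : Fin 3, X ≠ Y ∧ Y ≠ Z ∧ X ≠ Z ∧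
      (∀ i : Fin n, k - p ≤ (i : ℕ) → (i : ℕ) < k → s i = X) ∧
      (∀ i : Fin n, (i : ℕ) < k - p → s i = Y) ∧
      (∀ i : Fin n, k - p - q ≤ (i : ℕ) → (i : ℕ) < k → s' i = Z) ∧
      (∀ i : Fin n, (i : ℕ) < k - p - q ∨ k ≤ (i : ℕ) → s' i = s i) := by
  constructor
  · rintro ⟨h1, hn, X, Y, Z, hXY, hYZ, hXZ, hX, -, hY, hZ, hs⟩
    exact ⟨h1, hn, X, Y, Z, hXY, hYZ, hXZ, fun i h h' => hX i (by omega) (by omega),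
      fun i h => hY i (by omega), fun i h h' => hZ i (by omega) (by omega),
      fun i h => hs i (by omega)⟩
  · rintro ⟨h1, hn, X, Y, Z, hXY, hYZ, hXZ, hX, hY, hZ, hs⟩
    exact ⟨h1, hn, X, Y, Z, hXY, hYZ, hXZ, fun i h h' => hX i (by omega) (by omega),
      fun i h => by rw [hY i (by omega)]; exact hXY.symm, fun i h => hY i (by omega),
      fun i h h' => hZ i (by omega) (by omega), fun i h => hs i (by omega)⟩

/-- `MoveSeq p q n K s w t`: the states in the list `w` are those visited after `s` by a sequence
of moves with parameters `k < K` leading from `s` to `t`. -/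
inductive MoveSeq (p q n K : ℕ) : (Fin n → Fin 3) → List (Fin n → Fin 3) → (Fin n → Fin 3) → Prop
  | nil (s : Fin n → Fin 3) : MoveSeq p q n K s [] s
  | cons {k : ℕ} {s u t : Fin n → Fin 3} {w : List (Fin n → Fin 3)} (hk : k < K)
      (hm : PQMove p q n k s u) (hw : MoveSeq p q n K u w t) : MoveSeq p q n K s (u :: w) t

namespace MoveSeq

variable {K K' : ℕ} {s t u : Fin n → Fin 3} {w w' : List (Fin n → Fin 3)}

theorem mono (h : MoveSeq p q n K s w t) (hK : K ≤ K') : MoveSeq p q n K' s w t := by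
  induction h with
  | nil s => exact .nil s
  | cons hk hm _ ih => exact .cons (hk.trans_le hK) hm ih

theorem append (h : MoveSeq p q n K s w u) (h' : MoveSeq p q n K u w' t) :
    MoveSeq p q n K s (w ++ w') t := by
  induction h with
  | nil s => exact h'
  | cons hk hm _ ih => exact .cons hk hm (ih h')

theorem eq_of_le (h : MoveSeq p q n K s w t) (i : Fin n) (hi : K ≤ (i : ℕ) + 1) : t i = s i := by
  induction h with
  | nil s => rfl
  | cons hk hm _ ih =>
    obtain ⟨-, -, X, Y, Z, -, -, -, -, -, -, hs⟩ := pqMove_iff.1 hm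
    rw [ih, hs i (by omega)]

theorem split_first (h : MoveSeq p q n K s w t) (N : ℕ) :
    MoveSeq p q n N s w t ∨ ∃ w₁ s₁ k u w₂, w = w₁ ++ u :: w₂ ∧ MoveSeq p q n N s w₁ s₁ ∧
      N ≤ k ∧ k < K ∧ PQMove p q n k s₁ u ∧ MoveSeq p q n K u w₂ t := by
  induction h with
  | nil s => exact .inl (.nil s)
  | @cons k s u t w hk hm hw ih =>
    by_cases hN : N ≤ k
    · exact .inr ⟨[], s, k, u, w, rfl, .nil s, hN, hk, hm, hw⟩
    · push Not at hN
      rcases ih with ih | ⟨w₁, s₁, k', u', w₂, rfl, h₁, h⟩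
      · exact .inl (.cons hN hm ih)
      · exact .inr ⟨u :: w₁, s₁, k', u', w₂, rfl, .cons hN hm h₁, h⟩

theorem split_last (h : MoveSeq p q n K s w t) (N : ℕ) :
    MoveSeq p q n N s w t ∨ ∃ k s' v w₃, N ≤ k ∧ k < K ∧ PQMove p q n k s' v ∧
      MoveSeq p q n N v w₃ t ∧ w₃.length < w.length := by
  induction h with
  | nil s => exact .inl (.nil s)
  | @cons k s u t w hk hm hw ih =>
    rcases ih with ih | ⟨k', s', v, w₃, h1, h2, h3, h4, h5⟩
    · by_cases hN : N ≤ k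
      · exact .inr ⟨k, s, u, w, hN, hk, hm, ih, by simp⟩
      · exact .inl (.cons (by omega) hm ih)
    · exact .inr ⟨k', s', v, w₃, h1, h2, h3, h4, by simp; omega⟩

theorem exists_last {N k : ℕ} (hN : N ≤ k) (hk : k < K) (hm : PQMove p q n k s u)
    (h : MoveSeq p q n K u w t) :
    ∃ k' s' v w₃, N ≤ k' ∧ k' < K ∧ PQMove p q n k' s' v ∧ MoveSeq p q n N v w₃ t ∧
      (w₃.length < w.length ∨ (k' = k ∧ v = u ∧ w₃ = w)) := by
  rcases h.split_last N with h | ⟨k', s', v, w₃, h1, h2, h3, h4, h5⟩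
  · exact ⟨k, s, u, w, hN, hk, hm, h, .inr ⟨rfl, rfl, rfl⟩⟩
  · exact ⟨k', s', v, w₃, h1, h2, h3, h4, .inl h5⟩

end MoveSeq

/-- The recursion satisfied by the optimal lengths, with truncated subtraction. -/
structure IsLength (p q : ℕ) (M : ℕ → ℕ) : Prop where
  zero : M 0 = 0
  rec_eq : ∀ j, 0 < j → M j = M (j - p) + M (j - p - q) + 1

theorem IsLength.monotone {M : ℕ → ℕ} (hM : IsLength p q M) (hp : 1 ≤ p) : Monotone M := by
  intro a b
  induction b using Nat.strong_induction_on generalizing a with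
  | _ b ih =>
    intro hab
    rcases Nat.eq_zero_or_pos a with rfl | ha
    · simp [hM.zero]
    · rw [hM.rec_eq a ha, hM.rec_eq b (by omega)]
      have h1 := @ih (b - p) (by omega) (a - p) (by omega)
      have h2 := @ih (b - p - q) (by omega) (a - p - q) (by omega)
      omega

theorem exists_third (P Q : Fin 3) (h : P ≠ Q) : ∃ Y : Fin 3, P ≠ Y ∧ Y ≠ Q := by
  revert P Q; decide

theorem third_unique {P Q Y Y' : Fin 3} (h : P ≠ Q) (h1 : Y ≠ P) (h2 : Y ≠ Q) (h3 : Y' ≠ P)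
    (h4 : Y' ≠ Q) : Y = Y' := by
  revert P Q Y Y'; decide

/-- The tower of the `N` smallest disks can be transferred in `M N` moves. -/
theorem exists_moveSeq {M : ℕ → ℕ} (hM : IsLength p q M) (hp : 1 ≤ p) (N : ℕ) (hN : N ≤ n)
    (s : Fin n → Fin 3) (P Q : Fin 3) (hPQ : P ≠ Q) (hs : ∀ i : Fin n, (i : ℕ) < N → s i = P) :
    ∃ w, w.length = M N ∧ MoveSeq p q n (N + 1) s w (fun i => if (i : ℕ) < N then Q else s i) := by
  induction N using Nat.strong_induction_on generalizing s P Q with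
  | _ N ih =>
    rcases Nat.eq_zero_or_pos N with rfl | hpos
    · exact ⟨[], by simp [hM.zero], by simpa using .nil s⟩
    obtain ⟨Y, hPY, hYQ⟩ := exists_third P Q hPQ
    obtain ⟨w₁, hl₁, h₁⟩ := ih (N - p) (by omega) (by omega) s P Y hPY
      (fun i hi => hs i (by omega))
    set s₁ : Fin n → Fin 3 := fun i => if (i : ℕ) < N - p then Y else s i with hs₁
    set u : Fin n → Fin 3 := fun i =>
      if (i : ℕ) < N - p - q then Y else if (i : ℕ) < N then Q else s i with hu
    obtain ⟨w₂, hl₂, h₂⟩ := ih (N - p - q) (by omega) (by omega) u Y Q hYQ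
      (fun i hi => by simp [hu, hi])
    have hend : (fun i : Fin n => if (i : ℕ) < N - p - q then Q else u i) =
        fun i : Fin n => if (i : ℕ) < N then Q else s i := by
      funext i
      simp only [hu]
      split_ifs <;> first | rfl | omega
    have hm : PQMove p q n N s₁ u := by
      refine pqMove_iff.2 ⟨hpos, hN, P, Y, Q, hPY, hYQ, hPQ, ?_, ?_, ?_, ?_⟩
      · intro i h h'
        simp only [hs₁]
        rw [if_neg (by omega), hs i h']
      · intro i h
        simp [hs₁, h]
      · intro i h h'
        simp only [hu]
        rw [if_neg (by omega), if_pos h']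
      · intro i h
        simp only [hu, hs₁]
        split_ifs <;> first | rfl | omega
    refine ⟨w₁ ++ u :: w₂, ?_, ?_⟩
    · rw [hM.rec_eq N hpos]
      simp [hl₁, hl₂]
      omega
    · rw [hend] at h₂
      exact (h₁.mono (by omega)).append (.cons (by omega) hm (h₂.mono (by omega)))

/-- A sequence of moves with parameters `< K` from `s` to `t` that brings the tower of the `N`
smallest disks from `P` to `Q`, with `K ≤ N + p`. -/
structure IsTransfer (p q n N K : ℕ) (s : Fin n → Fin 3) (w : List (Fin n → Fin 3))
    (t : Fin n → Fin 3) (P Q : Fin 3) : Prop where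
  le : N ≤ n
  bound : K ≤ N + p
  seq : MoveSeq p q n K s w t
  ne : P ≠ Q
  start : ∀ i : Fin n, (i : ℕ) < N → s i = P
  finish : ∀ i : Fin n, (i : ℕ) < N → t i = Q

/-- A sequence of moves with parameters `< K` from `s` to `t` that brings the tower of the `N`
smallest disks from `R` onto the further disks `< K`, which lie on `Q` both at the start and at
the end, with `K ≤ N + p + q`. -/
structure IsMerge (p q n N K : ℕ) (s : Fin n → Fin 3) (w : List (Fin n → Fin 3))
    (t : Fin n → Fin 3) (R Q : Fin 3) : Prop where
  le : N ≤ n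
  bound : K ≤ N + p + q
  seq : MoveSeq p q n K s w t
  ne : R ≠ Q
  start : ∀ i : Fin n, (i : ℕ) < N → s i = R
  base : ∀ i : Fin n, N ≤ (i : ℕ) → (i : ℕ) + 1 < K → s i = Q
  finish : ∀ i : Fin n, (i : ℕ) < N → t i = Q
  fixed : ∀ i : Fin n, N ≤ (i : ℕ) → t i = s i

section

variable {N K : ℕ} {s t : Fin n → Fin 3} {w : List (Fin n → Fin 3)} {P Q R : Fin 3}

theorem IsMerge.transfer (h : IsMerge p q n N K s w t R Q) (hK : K ≤ N + p) :
    IsTransfer p q n N K s w t R Q :=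
  ⟨h.le, hK, h.seq, h.ne, h.start, h.finish⟩

/-- Decomposition of a transfer at the first and last moves of disk `N`. -/
theorem IsTransfer.decompose (h : IsTransfer p q n N K s w t P Q) (hN : 0 < N) :
    ∃ w₁ s₁ k u w₂ k' v w₃ Y Y', w = w₁ ++ u :: w₂ ∧ N ≤ k ∧ k < K ∧ N ≤ k' ∧ k' < K ∧
      PQMove p q n k s₁ u ∧ IsTransfer p q n (k - p) N s w₁ s₁ P Y ∧
      IsMerge p q n (k' - p - q) N v w₃ t Y' Q ∧
      (w₃.length < w₂.length ∨ (k' = k ∧ v = u ∧ w₃ = w₂)) := by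
  have hle := h.le
  have hb := h.bound
  let d : Fin n := ⟨N - 1, by omega⟩
  have hd : (d : ℕ) = N - 1 := rfl
  rcases h.seq.split_first N with h0 | ⟨w₁, s₁, k, u, w₂, rfl, h₁, hNk, hkK, hm, h₂⟩
  · have := h0.eq_of_le d (by omega)
    rw [h.start d (by omega), h.finish d (by omega)] at this
    exact absurd this.symm h.ne
  obtain ⟨k', s', v, w₃, hNk', hkK', hm', h₃, hl⟩ := MoveSeq.exists_last hNk hkK hm h₂
  obtain ⟨-, hkn, X, Y, Z, hXY, hYZ, hXZ, hX, hY, hZ, hs⟩ := pqMove_iff.1 hm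
  obtain ⟨-, hkn', X', Y', Z', hXY', hYZ', hXZ', hX', hY', hZ', hs'⟩ := pqMove_iff.1 hm'
  have e1 : X = P := by
    rw [← hX d (by omega) (by omega), h₁.eq_of_le d (by omega), h.start d (by omega)]
  have e2 : Z' = Q := by
    rw [← hZ' d (by omega) (by omega), ← h₃.eq_of_le d (by omega), h.finish d (by omega)]
  subst e1 e2
  refine ⟨w₁, s₁, k, u, w₂, k', v, w₃, Y, Y', rfl, hNk, hkK, hNk', hkK', hm, ?_, ?_, hl⟩
  · exact ⟨by omega, by omega, h₁, hXY, fun i hi => h.start i (by omega), hY⟩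
  · refine ⟨by omega, by omega, h₃, hYZ', ?_, fun i hi hi' => hZ' i hi (by omega),
      fun i hi => h.finish i (by omega), ?_⟩
    · intro i hi
      rw [hs' i (.inl hi), hY' i (by omega)]
    · intro i hi
      by_cases hiN : (i : ℕ) < N
      · rw [h.finish i hiN, hZ' i hi (by omega)]
      · exact h₃.eq_of_le i (by omega)

/-- If the largest admissible move occurs in a merge with `N + p < K`, then the merge is too
long. -/
theorem IsMerge.seq_or_lt {M : ℕ → ℕ} (hM : IsLength p q M) (hp : 1 ≤ p) {k : ℕ}
    (h : IsMerge p q n N (k + 1) s w t R Q) (hN : 0 < N) (hk : N + p ≤ k)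
    (hT : ∀ w s t P Q, IsTransfer p q n (k - p) k s w t P Q → M (k - p) ≤ w.length)
    (hS : ∀ w s t P Q, IsMerge p q n (k - p - q) k s w t P Q → M (k - p - q) ≤ w.length) :
    MoveSeq p q n k s w t ∨ M N < w.length := by
  refine or_iff_not_imp_left.2 fun h0 => ?_
  have hb := h.bound
  rcases h.seq.split_first k with h1 | ⟨w₁, s₁, k₁, u, w₂, rfl, h₁, hk₁, hk₁', hm, h₂⟩
  · exact absurd h1 h0
  obtain rfl : k₁ = k := by omega
  obtain ⟨-, hkn, X, Y, Z, hXY, hYZ, hXZ, hX, hY, hZ, hs⟩ := pqMove_iff.1 hm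
  let d : Fin n := ⟨k₁ - 1, by omega⟩
  have hd : (d : ℕ) = k₁ - 1 := rfl
  have e1 : X = Q := by
    rw [← hX d (by omega) (by omega), h₁.eq_of_le d (by omega), h.base d (by omega) (by omega)]
  subst e1
  have htd : t d = X := by rw [h.fixed d (by omega), h.base d (by omega) (by omega)]
  rcases h₂.split_first k₁ with h2 | ⟨b, s₂, k₂, u₂, w₄, rfl, h₂, hk₂, hk₂', hm₂, h₄⟩
  · have := h2.eq_of_le d (by omega)
    rw [htd, hZ d (by omega) (by omega)] at this
    exact absurd this hXZ
  obtain rfl : k₂ = k₁ := by omega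
  obtain ⟨k', s', v, w₃, hk', hkK', hm₃, h₃, hl⟩ := MoveSeq.exists_last hk₂ hk₂' hm₂ h₄
  obtain rfl : k' = k₂ := by omega
  obtain ⟨-, -, X₂, Y₂, Z₂, hXY₂, -, -, hX₂, hY₂, -, -⟩ := pqMove_iff.1 hm₂
  obtain ⟨-, -, X₃, Y₃, Z₃, hXY₃, hYZ₃, hXZ₃, hX₃, hY₃, hZ₃, hs₃⟩ := pqMove_iff.1 hm₃
  have e2 : X₂ = Z := by
    rw [← hX₂ d (by omega) (by omega), h₂.eq_of_le d (by omega), hZ d (by omega) (by omega)]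
  have e3 : Z₃ = X := by
    rw [← hZ₃ d (by omega) (by omega), ← h₃.eq_of_le d (by omega), htd]
  subst e2 e3
  have hlast : M (k' - p - q) ≤ w₃.length := by
    refine hS w₃ v t Y₃ Z₃ ⟨by omega, by omega, h₃, hYZ₃, ?_, fun i hi hi' => hZ₃ i hi (by omega),
      fun i hi => h.finish i (by omega), ?_⟩
    · intro i hi
      rw [hs₃ i (.inl hi), hY₃ i (by omega)]
    · intro i hi
      by_cases hiN : (i : ℕ) < k'
      · rw [hZ₃ i hi hiN]
        by_cases hi' : (i : ℕ) < N
        · exact h.finish i hi'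
        · rw [h.fixed i (by omega), h.base i (by omega) (by omega)]
      · exact h₃.eq_of_le i (by omega)
  have hmid : M (k' - p) ≤ M (k' - p - q) + b.length := by
    obtain ⟨a, hal, ha⟩ := exists_moveSeq hM hp (k' - p - q) (by omega)
      (fun i => if (i : ℕ) < k' - p - q then X₂ else u i) X₂ Y hYZ.symm
      (fun i hi => by simp [hi])
    have hau : (fun i : Fin n => if (i : ℕ) < k' - p - q then Y else
        if (i : ℕ) < k' - p - q then X₂ else u i) = u := by
      funext i
      split_ifs with hi
      · rw [hs i (.inl hi), hY i (by omega)]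
      · rfl
    rw [hau] at ha
    rw [← hal, ← List.length_append]
    refine hT _ _ s₂ X₂ Y₂ ⟨by omega, by omega, (ha.mono (by omega)).append h₂, hXY₂, ?_, hY₂⟩
    intro i hi
    split_ifs with hi'
    · rfl
    · exact hZ i (by omega) (by omega)
  have hmono : M N ≤ M (k' - p) := hM.monotone hp (by omega)
  have hl' : w₃.length ≤ w₄.length := by
    rcases hl with hl | ⟨-, -, rfl⟩ <;> omega
  simp only [List.length_append, List.length_cons]
  omega

end

theorem length_bounds {M : ℕ → ℕ} (hM : IsLength p q M) (hp : 1 ≤ p) (N : ℕ) :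
    (∀ K w (s t : Fin n → Fin 3) P Q, IsTransfer p q n N K s w t P Q → M N ≤ w.length) ∧
    (∀ N', N' + q = N → ∀ K w (s t : Fin n → Fin 3) P Q,
      IsMerge p q n N' K s w t P Q → M N' ≤ w.length) := by
  induction N using Nat.strong_induction_on with
  | _ N ih =>
    have hT : ∀ K w (s t : Fin n → Fin 3) P Q, IsTransfer p q n N K s w t P Q →
        M N ≤ w.length := by
      intro K w s t P Q h
      rcases Nat.eq_zero_or_pos N with rfl | hN
      · simp [hM.zero]
      have hb := h.bound
      obtain ⟨w₁, s₁, k, u, w₂, k', v, w₃, Y, Y', rfl, hk, hkK, hk', hkK', hm, h₁, h₃, hl⟩ :=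
        h.decompose hN
      have b₁ := (ih (k - p) (by omega)).1 _ _ _ _ _ _ h₁
      have b₃ : M (k' - p - q) ≤ w₃.length := by
        rcases Nat.eq_zero_or_pos (k' - p - q) with h0 | h0
        · simp [h0, hM.zero]
        · exact (ih (k' - p - q + q) (by omega)).2 _ rfl _ _ _ _ _ _ h₃
      have m₁ : M (N - p) ≤ M (k - p) := hM.monotone hp (by omega)
      have m₃ : M (N - p - q) ≤ M (k' - p - q) := hM.monotone hp (by omega)
      have hl' : w₃.length ≤ w₂.length := by
        rcases hl with hl | ⟨-, -, rfl⟩ <;> omega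
      rw [hM.rec_eq N hN]
      simp only [List.length_append, List.length_cons]
      omega
    refine ⟨hT, ?_⟩
    rintro N' hN' K w s t P Q h
    rcases Nat.eq_zero_or_pos N' with rfl | hpos
    · simp [hM.zero]
    have hT' : ∀ K w (s t : Fin n → Fin 3) P Q, IsTransfer p q n N' K s w t P Q →
        M N' ≤ w.length := by
      rcases Nat.eq_zero_or_pos q with rfl | hq
      · obtain rfl : N' = N := by omega
        exact hT
      · exact (ih N' (by omega)).1
    induction K with
    | zero => exact hT' _ _ _ _ _ _ (h.transfer (by omega))
    | succ k ihk =>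
      by_cases hk : N' + p ≤ k
      · have hb := h.bound
        rcases h.seq_or_lt hM hp hpos hk (fun w s t P Q => (ih (k - p) (by omega)).1 k w s t P Q)
          (fun w s t P Q => (ih (k - p - q + q) (by omega)).2 _ rfl k w s t P Q) with h1 | h1
        · exact ihk ⟨h.le, by omega, h1, h.ne, h.start, fun i hi hi' => h.base i hi (by omega),
            h.finish, h.fixed⟩
        · exact h1.le
      · exact hT' _ _ _ _ _ _ (h.transfer (by omega))

theorem IsTransfer.length_le {M : ℕ → ℕ} (hM : IsLength p q M) (hp : 1 ≤ p) {N K : ℕ}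
    {s t : Fin n → Fin 3} {w : List (Fin n → Fin 3)} {P Q : Fin 3}
    (h : IsTransfer p q n N K s w t P Q) : M N ≤ w.length :=
  (length_bounds hM hp N).1 _ _ _ _ _ _ h

theorem IsMerge.length_le {M : ℕ → ℕ} (hM : IsLength p q M) (hp : 1 ≤ p) {N K : ℕ}
    {s t : Fin n → Fin 3} {w : List (Fin n → Fin 3)} {P Q : Fin 3}
    (h : IsMerge p q n N K s w t P Q) : M N ≤ w.length :=
  (length_bounds hM hp (N + q)).2 _ rfl _ _ _ _ _ _ h

/-- A transfer of minimal length that fixes the larger disks moves disk `N` only once. -/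
theorem IsTransfer.decompose_of_length_le {M : ℕ → ℕ} (hM : IsLength p q M) (hp : 1 ≤ p)
    {N K : ℕ} {s t : Fin n → Fin 3} {w : List (Fin n → Fin 3)} {P Q : Fin 3}
    (h : IsTransfer p q n N K s w t P Q) (hN : 0 < N)
    (hfix : ∀ i : Fin n, N ≤ (i : ℕ) → t i = s i) (hl : w.length ≤ M N) :
    ∃ w₁ s₁ u w₂ Y, w = w₁ ++ u :: w₂ ∧ Y ≠ P ∧ Y ≠ Q ∧
      s₁ = (fun i : Fin n => if (i : ℕ) < N - p then Y else s i) ∧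
      u = (fun i : Fin n => if (i : ℕ) < N - p - q then Y else if (i : ℕ) < N then Q else s i) ∧
      w₁.length ≤ M (N - p) ∧ w₂.length ≤ M (N - p - q) ∧
      IsTransfer p q n (N - p) N s w₁ s₁ P Y ∧ IsMerge p q n (N - p - q) N u w₂ t Y Q := by
  have hle := h.le
  have hb := h.bound
  obtain ⟨w₁, s₁, k, u, w₂, k', v, w₃, Y, Y', rfl, hk, hkK, hk', hkK', hm, h₁, h₃, hl₃⟩ :=
    h.decompose hN
  have b₁ := h₁.length_le hM hp
  have b₃ := h₃.length_le hM hp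
  have m₁ : M (N - p) ≤ M (k - p) := hM.monotone hp (by omega)
  have m₃ : M (N - p - q) ≤ M (k' - p - q) := hM.monotone hp (by omega)
  rw [hM.rec_eq N hN] at hl
  simp only [List.length_append, List.length_cons] at hl
  rcases hl₃ with hl₃ | ⟨rfl, rfl, rfl⟩
  · omega
  obtain ⟨-, hkn, X, Y₁, Z, hXY, hYZ, hXZ, hX, hY, hZ, hs⟩ := pqMove_iff.1 hm
  obtain rfl : N = k' := by
    by_contra hne
    have e1 := hX ⟨k' - 1, by omega⟩ (by simp; omega) (by simp; omega)
    have e2 := hZ ⟨k' - 1, by omega⟩ (by simp; omega) (by simp; omega)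
    rw [h₁.seq.eq_of_le _ (by simp; omega), ← hfix _ (by simp; omega),
      h₃.seq.eq_of_le _ (by simp; omega), e2] at e1
    exact hXZ e1.symm
  let d : Fin n := ⟨N - 1, by omega⟩
  have hd : (d : ℕ) = N - 1 := rfl
  have e1 : X = P := by
    rw [← hX d (by omega) (by omega), h₁.seq.eq_of_le d (by omega), h.start d (by omega)]
  have e2 : Z = Q := by
    rw [← hZ d (by omega) (by omega), ← h₃.seq.eq_of_le d (by omega), h.finish d (by omega)]
  subst e1 e2
  have hs₁ : s₁ = fun i : Fin n => if (i : ℕ) < N - p then Y₁ else s i := by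
    funext i
    split_ifs with hi
    · exact hY i hi
    · by_cases hi' : (i : ℕ) < N
      · rw [hX i (by omega) hi', h.start i hi']
      · exact h₁.seq.eq_of_le i (by omega)
  have hu : v = fun i : Fin n =>
      if (i : ℕ) < N - p - q then Y₁ else if (i : ℕ) < N then Z else s i := by
    funext i
    split_ifs with hi hi'
    · rw [hs i (.inl hi), hY i (by omega)]
    · exact hZ i (by omega) hi'
    · rw [hs i (by omega), h₁.seq.eq_of_le i (by omega)]
  exact ⟨w₁, s₁, v, w₃, Y₁, rfl, hXY.symm, hYZ, hs₁, hu, by omega, by omega,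
    ⟨h₁.le, h₁.bound, h₁.seq, hXY, h₁.start, hY⟩,
    ⟨h₃.le, h₃.bound, h₃.seq, hYZ, fun i hi => by simp [hu, hi], h₃.base, h₃.finish, h₃.fixed⟩⟩

theorem IsMerge.transfer_of_length_le {M : ℕ → ℕ} (hM : IsLength p q M) (hp : 1 ≤ p)
    {N K : ℕ} {s t : Fin n → Fin 3} {w : List (Fin n → Fin 3)} {P Q : Fin 3}
    (h : IsMerge p q n N K s w t P Q) (hN : 0 < N) (hl : w.length ≤ M N) :
    ∃ K', IsTransfer p q n N K' s w t P Q := by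
  induction K with
  | zero => exact ⟨_, h.transfer (by omega)⟩
  | succ k ihk =>
    by_cases hk : N + p ≤ k
    · have hb := h.bound
      rcases h.seq_or_lt hM hp hN hk (fun w s t P Q h' => h'.length_le hM hp)
        (fun w s t P Q h' => h'.length_le hM hp) with h1 | h1
      · exact ihk ⟨h.le, by omega, h1, h.ne, h.start, fun i hi hi' => h.base i hi (by omega),
          h.finish, h.fixed⟩
      · omega
    · exact ⟨_, h.transfer (by omega)⟩

theorem IsTransfer.unique {M : ℕ → ℕ} (hM : IsLength p q M) (hp : 1 ≤ p)
    {N K K' : ℕ} {s t : Fin n → Fin 3} {w w' : List (Fin n → Fin 3)} {P Q : Fin 3}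
    (h : IsTransfer p q n N K s w t P Q) (h' : IsTransfer p q n N K' s w' t P Q)
    (hfix : ∀ i : Fin n, N ≤ (i : ℕ) → t i = s i) (hl : w.length ≤ M N)
    (hl' : w'.length ≤ M N) : w = w' := by
  induction N using Nat.strong_induction_on generalizing K K' s t w w' P Q with
  | _ N ih =>
    have eq_nil : ∀ {a b : List (Fin n → Fin 3)} {j : ℕ}, j = 0 → a.length ≤ M j →
        b.length ≤ M j → a = b := by
      rintro a b j rfl ha hb
      rw [hM.zero, Nat.le_zero, List.length_eq_zero_iff] at ha hb
      rw [ha, hb]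
    rcases Nat.eq_zero_or_pos N with hN | hN
    · exact eq_nil hN hl hl'
    obtain ⟨w₁, s₁, u, w₂, Y, rfl, hYP, hYQ, hs₁, hu, l₁, l₂, h₁, h₂⟩ :=
      h.decompose_of_length_le hM hp hN hfix hl
    obtain ⟨w₁', s₁', u', w₂', Y', rfl, hYP', hYQ', hs₁', hu', l₁', l₂', h₁', h₂'⟩ :=
      h'.decompose_of_length_le hM hp hN hfix hl'
    obtain rfl := third_unique h.ne hYP hYQ hYP' hYQ'
    obtain rfl : s₁ = s₁' := hs₁.trans hs₁'.symm
    obtain rfl : u = u' := hu.trans hu'.symm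
    have e₁ : w₁ = w₁' := ih (N - p) (by omega) h₁ h₁'
      (fun i hi => by rw [hs₁]; exact if_neg (by omega)) l₁ l₁'
    have e₂ : w₂ = w₂' := by
      rcases Nat.eq_zero_or_pos (N - p - q) with h0 | h0
      · exact eq_nil h0 l₂ l₂'
      · obtain ⟨_, g⟩ := h₂.transfer_of_length_le hM hp h0 l₂
        obtain ⟨_, g'⟩ := h₂'.transfer_of_length_le hM hp h0 l₂'
        exact ih (N - p - q) (by omega) g g' h₂.fixed l₂ l₂'
    rw [e₁, e₂]

theorem moveSeq_of_forall (l : ℕ) (s : ℕ → (Fin n → Fin 3))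
    (h : ∀ i < l, ∃ k, PQMove p q n k (s i) (s (i + 1))) :
    MoveSeq p q n (n + 1) (s 0) ((List.range l).map fun i => s (i + 1)) (s l) := by
  induction l with
  | zero => exact .nil _
  | succ l ih =>
    rw [List.range_succ, List.map_append]
    obtain ⟨k, hk⟩ := h l (by omega)
    exact (ih fun i hi => h i (by omega)).append
      (.cons (Nat.lt_succ_of_le (pqMove_iff.1 hk).2.1) hk (.nil _))

theorem MoveSeq.exists_forall {K : ℕ} {s t : Fin n → Fin 3} {w : List (Fin n → Fin 3)}
    (h : MoveSeq p q n K s w t) : ∃ f : ℕ → (Fin n → Fin 3), f 0 = s ∧ f w.length = t ∧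
      ∀ i < w.length, ∃ k, PQMove p q n k (f i) (f (i + 1)) := by
  induction h with
  | nil s => exact ⟨fun _ => s, rfl, rfl, by simp⟩
  | @cons k s u t w hk hm hw ih =>
    obtain ⟨f, h0, hl, hf⟩ := ih
    refine ⟨fun i => Nat.casesOn i s f, rfl, hl, ?_⟩
    rintro (_ | i) hi
    · exact ⟨k, by simpa [h0] using hm⟩
    · exact hf i (by simpa using hi)

theorem isTransfer_of_isPQSolution {l : ℕ} {s : ℕ → (Fin n → Fin 3)} (hp : 1 ≤ p)
    (h : IsPQSolution p q n l s) :
    IsTransfer p q n n (n + 1) (fun _ => 0) ((List.range l).map fun i => s (i + 1))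
      (fun _ => 2) 0 2 := by
  have := moveSeq_of_forall l s h.2.2
  rw [h.1, h.2.1] at this
  exact ⟨le_rfl, by omega, this, by decide, fun _ _ => rfl, fun _ _ => rfl⟩

end PQHanoi

/-- Let `p ≥ 1` and `q ≥ 0`.  For every `n ≥ 0`, the `(p,q)`-Tower of
Hanoi with `n` disks admits a solution, there is exactly one solution of minimal
length, and this minimal length is `m n`, where `m : ℤ → ℕ` satisfies `m j = 0` for
`j ≤ 0` and `m j = m (j - p) + m (j - p - q) + 1` for `j > 0`. -/
theorem pqTowerOfHanoi_optimal (p q : ℕ) (hp : 1 ≤ p) (m : ℤ → ℕ)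
    (hm0 : ∀ j : ℤ, j ≤ 0 → m j = 0)
    (hmrec : ∀ j : ℤ, 0 < j → m j = m (j - p) + m (j - p - q) + 1)
    (n : ℕ) :
    (∃ s, IsPQSolution p q n (m n) s) ∧
    (∀ l s, IsPQSolution p q n l s → m n ≤ l) ∧
    (∀ s s', IsPQSolution p q n (m n) s → IsPQSolution p q n (m n) s' →
      ∀ i ≤ m n, s i = s' i) := by
  have hM : PQHanoi.IsLength p q (fun j => m j) := by
    have trunc (j d : ℕ) : m ((j : ℤ) - d) = m ((j - d : ℕ) : ℤ) := by
      rcases le_total d j with h | h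
      · rw [Nat.cast_sub h]
      · rw [hm0 _ (by omega), hm0 _ (by omega)]
    refine ⟨hm0 _ le_rfl, fun j hj => ?_⟩
    have := trunc j (p + q)
    rw [Nat.cast_add, ← sub_sub, ← Nat.sub_sub] at this
    rw [hmrec j (by omega), trunc, this]
  refine ⟨?_, fun l s h => ?_, fun s s' h h' i hi => ?_⟩
  · obtain ⟨w, hl, hw⟩ := PQHanoi.exists_moveSeq (n := n) hM hp n le_rfl (fun _ => 0) 0 2
      (by decide) (fun _ _ => rfl)
    obtain ⟨f, h0, h1, hf⟩ := hw.exists_forall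
    rw [hl] at h1 hf
    exact ⟨f, h0, by rw [h1]; funext i; simp, hf⟩
  · simpa using (PQHanoi.isTransfer_of_isPQSolution hp h).length_le hM hp
  · have := (PQHanoi.isTransfer_of_isPQSolution hp h).unique hM hp
      (PQHanoi.isTransfer_of_isPQSolution hp h') (fun i hi => by omega) (by simp) (by simp)
    rcases i with _ | i
    · rw [h.1, h'.1]
    · exact List.map_inj_left.1 this i (by simpa using hi)
end

section
/- In the linear Tower of Hanoi-Fibonacci, the puzzle with n disks is solvable for every n ≥ 0, and the minimal number m_n of permitted moves needed to go from the state with all disks on peg A to the state with all disks on peg C satisfies m_0 = 0, m_1 = 2, m_2 = 5, and m_n = m_{n−1} + m_{n−2} + m_{n−3} + 3 for every n ≥ 3. -/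
/-- A `k`-Fibonacci move of the *linear* Tower of Hanoi-Fibonacci with `n` disks:
a `k`-Fibonacci move (disk `k` on peg `X` with no smaller disk on `X`, disks
`1,…,k-1` on peg `Y`, and disks `k-1` and `k` — only disk `1` when `k = 1` — moved
onto the third peg `Z`) which is permitted only if `(X, Z)` is one of
`(A, B), (B, A), (B, C), (C, B)` (pegs are `0 = A`, `1 = B`, `2 = C`). -/
def LinFibMove (n k : ℕ) (s s' : Fin n → Fin 3) : Prop :=
  1 ≤ k ∧ k ≤ n ∧
  ∃ X Y Z : Fin 3, X ≠ Y ∧ Y ≠ Z ∧ X ≠ Z ∧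
    ((X : ℕ) + 1 = (Z : ℕ) ∨ (Z : ℕ) + 1 = (X : ℕ)) ∧
    (∀ i : Fin n, (i : ℕ) + 1 = k → s i = X) ∧
    (∀ i : Fin n, (i : ℕ) + 1 < k → s i ≠ X) ∧
    (∀ i : Fin n, (i : ℕ) + 1 < k → s i = Y) ∧
    (∀ i : Fin n, ((i : ℕ) + 1 = k ∨ (i : ℕ) + 2 = k) → s' i = Z) ∧
    (∀ i : Fin n, (i : ℕ) + 1 ≠ k → (i : ℕ) + 2 ≠ k → s' i = s i)

/-- `s 0, s 1, …, s m` is a solution of length `m` of the linear Tower of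
Hanoi-Fibonacci with `n` disks. -/
def IsLinSolution (n m : ℕ) (s : ℕ → (Fin n → Fin 3)) : Prop :=
  (s 0 = fun _ => 0) ∧ (s m = fun _ => 2) ∧ ∀ i < m, ∃ k, LinFibMove n k (s i) (s (i + 1))

/-- The claimed length of an optimal solution of the linear Tower of Hanoi-Fibonacci. -/
def optLength : ℕ → ℕ
  | 0 => 0
  | 1 => 2
  | 2 => 5
  | n + 3 => optLength (n + 2) + optLength (n + 1) + optLength n + 3

lemma optLength_succ {n : ℕ} (hn : 1 ≤ n) :
    optLength (n + 1) = optLength n + optLength (n - 1) + optLength (n - 2) + 3 := by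
  obtain _ | _ | n := n
  · omega
  · simp [optLength]
  · simp [optLength]

lemma optLength_mono : Monotone optLength := by
  refine monotone_nat_of_le_succ fun n => ?_
  obtain _ | n := n
  · simp [optLength]
  · rw [optLength_succ (n := n + 1) (by omega)]
    omega

/-- The move whose largest moved disk is `d` (counted from `0`), on configurations of infinitely
many disks. -/
def FibStep (d : ℕ) (s s' : ℕ → Fin 3) : Prop :=
  ∃ X Y Z : Fin 3, X ≠ Y ∧ Y ≠ Z ∧ X ≠ Z ∧ (X = 1 ∨ Z = 1) ∧ s d = X ∧ (∀ i < d, s i = Y) ∧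
    s' d = Z ∧ (∀ i, i + 1 = d → s' i = Z) ∧ ∀ i, i ≠ d → i + 1 ≠ d → s' i = s i

/-- `FibPath n m s t`: there is a sequence of `m` moves of the `n` smallest disks leading from
`s` to `t`. -/
inductive FibPath_s17 (n : ℕ) : ℕ → (ℕ → Fin 3) → (ℕ → Fin 3) → Prop
  | nil (s : ℕ → Fin 3) : FibPath_s17 n 0 s s
  | cons {d m : ℕ} {s u t : ℕ → Fin 3} (hd : d < n) (h : FibStep d s u)
      (p : FibPath_s17 n m u t) : FibPath_s17 n (m + 1) s t

namespace FibPath_s17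

lemma trans {n a b : ℕ} {s u t : ℕ → Fin 3} (p : FibPath_s17 n a s u) (q : FibPath_s17 n b u t) :
    FibPath_s17 n (a + b) s t := by
  induction p with
  | nil => simpa using q
  | cons hd h _ ih =>
    rw [Nat.add_right_comm]
    exact cons hd h (ih q)

lemma single {n d : ℕ} {s t : ℕ → Fin 3} (hd : d < n) (h : FibStep d s t) : FibPath_s17 n 1 s t :=
  cons hd h (nil t)

lemma mono {n n' m : ℕ} {s t : ℕ → Fin 3} (hn : n ≤ n') (p : FibPath_s17 n m s t) :
    FibPath_s17 n' m s t := by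
  induction p with
  | nil => exact nil _
  | cons hd h _ ih => exact cons (hd.trans_le hn) h ih

lemma eq_of_le {n m : ℕ} {s t : ℕ → Fin 3} (p : FibPath_s17 n m s t) {i : ℕ} (hi : n ≤ i) :
    t i = s i := by
  induction p with
  | nil => rfl
  | cons hd h _ ih =>
    obtain ⟨X, Y, Z, -, -, -, -, -, -, -, -, h⟩ := h
    rw [ih, h i (by omega) (by omega)]

/-- Splitting a path at the first move of its largest disk. -/
lemma split {n m : ℕ} {s t : ℕ → Fin 3} (p : FibPath_s17 (n + 1) m s t) :
    FibPath_s17 n m s t ∨ ∃ a b u v, FibPath_s17 n a s u ∧ FibStep n u v ∧ FibPath_s17 (n + 1) b v t ∧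
      m = a + 1 + b := by
  induction p with
  | nil => exact .inl (nil _)
  | @cons d m s u t hd h p ih =>
    obtain rfl | hd := Nat.lt_succ_iff_lt_or_eq.mp hd |>.symm
    · exact .inr ⟨0, m, s, u, nil s, h, p, by omega⟩
    · obtain q | ⟨a, b, x, y, q, hs, r, rfl⟩ := ih
      · exact .inl (cons hd h q)
      · exact .inr ⟨a + 1, b, x, y, cons hd h q, hs, r, by omega⟩

end FibPath_s17

/-- `V` and `W` are the two extreme pegs. -/
def Extremes (V W : Fin 3) : Prop := V = 0 ∧ W = 2 ∨ V = 2 ∧ W = 0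

lemma Extremes.symm {V W : Fin 3} (h : Extremes V W) : Extremes W V := by
  unfold Extremes at *; tauto

lemma Extremes.ne {V W : Fin 3} (h : Extremes V W) : V ≠ W ∧ V ≠ 1 ∧ W ≠ 1 := by
  obtain ⟨rfl, rfl⟩ | ⟨rfl, rfl⟩ := h <;> decide

/-- The four possible moves of disk `n`. -/
lemma FibStep.cases {n : ℕ} {u v : ℕ → Fin 3} (h : FibStep n u v) {V W : Fin 3}
    (hVW : Extremes V W) :
    ∃ X Y Z, u n = X ∧ (∀ i < n, u i = Y) ∧ v n = Z ∧ (∀ i, i + 1 = n → v i = Z) ∧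
      (∀ i, i + 1 < n → v i = Y) ∧
      (X = V ∧ Y = W ∧ Z = 1 ∨ X = 1 ∧ Y = W ∧ Z = V ∨ X = 1 ∧ Y = V ∧ Z = W ∨
        X = W ∧ Y = V ∧ Z = 1) := by
  obtain ⟨X, Y, Z, h1, h2, h3, h4, h5, h6, h7, h8, h9⟩ := h
  refine ⟨X, Y, Z, h5, h6, h7, h8, fun i hi => ?_, ?_⟩
  · rw [h9 i (by omega) (by omega), h6 i (by omega)]
  · clear h5 h6 h7 h8 h9
    obtain ⟨rfl, rfl⟩ | ⟨rfl, rfl⟩ := hVW <;> revert X Y Z <;> decide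

/-- The move of disk `d` between the middle peg and an extreme peg, the smaller disks being on the
opposite extreme peg. -/
lemma exists_fibStep {d : ℕ} {s : ℕ → Fin 3} {X Y Z : Fin 3} (hXY : X ≠ Y) (hYZ : Y ≠ Z)
    (hXZ : X ≠ Z) (h1 : X = 1 ∨ Z = 1) (hX : s d = X) (hY : ∀ i < d, s i = Y) :
    ∃ t, FibStep d s t ∧ t d = Z ∧ (∀ i, i + 1 = d → t i = Z) ∧
      ∀ i, i ≠ d → i + 1 ≠ d → t i = s i := by
  refine ⟨fun i => if i = d ∨ i + 1 = d then Z else s i,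
    ⟨X, Y, Z, hXY, hYZ, hXZ, h1, hX, hY, ?_, ?_, ?_⟩, ?_, ?_, ?_⟩ <;> grind

lemma exists_fibPath (n : ℕ) : ∀ {V W : Fin 3}, Extremes V W → ∀ s : ℕ → Fin 3,
    (∀ i < n, s i = V) → ∃ t, FibPath_s17 n (optLength n) s t ∧ ∀ i < n, t i = W := by
  induction n using Nat.strong_induction_on with
  | _ n ih =>
  intro V W hVW s hs
  obtain ⟨hne, hV, hW⟩ := hVW.ne
  obtain _ | n := n
  · exact ⟨s, .nil s, by simp⟩
  obtain rfl | hn := Nat.eq_zero_or_pos n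
  · obtain ⟨t, ht, h1, -⟩ := exists_fibStep (d := 0) (s := s) (Y := W) hne hW hV (.inr rfl)
      (hs 0 (by omega)) (by simp)
    obtain ⟨u, hu, h2, -⟩ := exists_fibStep (d := 0) (s := t) (Y := V) hV.symm hne hW.symm
      (.inl rfl) h1 (by simp)
    refine ⟨u, .cons (by omega) ht (.cons (by omega) hu (.nil u)), fun i hi => ?_⟩
    obtain rfl : i = 0 := by omega
    exact h2
  obtain ⟨a, pa, ha⟩ := ih n (by omega) hVW s (fun i hi => hs i (by omega))
  have ha' : a n = V := (pa.eq_of_le le_rfl).trans (hs n (by omega))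
  obtain ⟨b, pb, hb1, hb2, hb3⟩ := exists_fibStep hne hW hV (.inr rfl) ha' ha
  obtain ⟨c, pc, hc1, hc2, hc3⟩ := exists_fibStep (d := n - 1) (s := b) (Y := W) hW.symm hne.symm
    hV.symm (.inl rfl) (hb2 _ (by omega))
    (fun i hi => (hb3 i (by omega) (by omega)).trans (ha i (by omega)))
  have hcW : ∀ i < n - 2, c i = W := fun i hi => by
    rw [hc3 i (by omega) (by omega), hb3 i (by omega) (by omega), ha i (by omega)]
  obtain ⟨e, pe, he⟩ := ih (n - 2) (by omega) hVW.symm c hcW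
  have heV : ∀ i < n, e i = V := fun i hi => by
    by_cases h : i < n - 2
    · exact he i h
    · rw [pe.eq_of_le (by omega)]
      obtain rfl | h' := eq_or_ne i (n - 1)
      · exact hc1
      · exact hc2 i (by omega)
  have hen : e n = 1 := by
    rw [pe.eq_of_le (by omega), hc3 n (by omega) (by omega), hb1]
  obtain ⟨f, pf, hf1, hf2, hf3⟩ := exists_fibStep hV.symm hne hW.symm (.inl rfl) hen heV
  obtain ⟨t, pt, ht⟩ := ih (n - 1) (by omega) hVW f
    (fun i hi => (hf3 i (by omega) (by omega)).trans (heV i (by omega)))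
  refine ⟨t, ?_, fun i hi => ?_⟩
  · have := (pa.mono n.le_succ).trans (.cons (by omega) pb (.cons (by omega) pc
      ((pe.mono (by omega)).trans (.cons n.lt_succ_self pf (pt.mono (by omega))))))
    convert this using 1
    rw [optLength_succ hn]
    omega
  · by_cases h : i < n - 1
    · exact ht i h
    · rw [pt.eq_of_le (by omega)]
      obtain rfl | h' := eq_or_ne i n
      · exact hf1
      · exact hf2 i (by omega)

/-- Lower bounds for the number of moves needed to gather `n` disks on the extreme peg `W`, from
four kinds of initial states. -/
structure GatherBounds (n : ℕ) : Prop where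
  far_far {V W : Fin 3} (hVW : Extremes V W) {m : ℕ} {s t : ℕ → Fin 3} (p : FibPath_s17 n m s t)
    (ht : ∀ i < n, t i = W) (hs : ∀ i < n, s i = V) : optLength n ≤ m
  far_near {V W : Fin 3} (hVW : Extremes V W) {m : ℕ} {s t : ℕ → Fin 3} (p : FibPath_s17 n m s t)
    (ht : ∀ i < n, t i = W) (hs : ∀ i, i + 1 < n → s i = V) (hs' : ∀ i, i + 1 = n → s i = W) :
    optLength (n - 1) ≤ m
  far_mid {V W : Fin 3} (hVW : Extremes V W) {m : ℕ} {s t : ℕ → Fin 3} (p : FibPath_s17 n m s t)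
    (ht : ∀ i < n, t i = W) (hs : ∀ i, i + 1 < n → s i = V) (hs' : ∀ i, i + 1 = n → s i = 1) :
    1 + optLength (n - 2) ≤ m
  near_mid {V W : Fin 3} (hVW : Extremes V W) {m : ℕ} {s t : ℕ → Fin 3} (p : FibPath_s17 n m s t)
    (ht : ∀ i < n, t i = W) (hs : ∀ i, i + 1 < n → s i = W) (hs' : ∀ i, i + 1 = n → s i = 1) :
    1 + optLength (n - 2) + optLength (n - 3) ≤ m

/-- Lower bounds from the four states that can occur just after a move of the largest disk. -/
lemma GatherBounds.after_move {n : ℕ} (hn : 1 ≤ n) (H : GatherBounds n) {V W : Fin 3}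
    (hVW : Extremes V W) (m : ℕ) : ∀ {Y Z : Fin 3} {s t : ℕ → Fin 3}, FibPath_s17 (n + 1) m s t →
    (∀ i < n + 1, t i = W) → s n = Z → (∀ i, i + 1 = n → s i = Z) → (∀ i, i + 1 < n → s i = Y) →
    (Y = V → Z = W → optLength (n - 1) ≤ m) ∧
    (Y = V → Z = 1 → 2 + optLength (n - 1) + optLength (n - 2) + optLength (n - 3) ≤ m) ∧
    (Y = W → Z = 1 → 2 + optLength (n - 1) + optLength (n - 2) ≤ m) ∧
    (Y = W → Z = V → 3 + optLength (n - 1) + optLength (n - 2) ≤ m) := by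
  obtain ⟨hne, hV, hW⟩ := hVW.ne
  have hmono : optLength (n - 3) ≤ optLength (n - 2) := optLength_mono (by omega)
  induction m using Nat.strong_induction_on with
  | _ m ih =>
  intro Y Z s t p ht hZ hZ' hY
  obtain q | ⟨a, b, u, v, q, hs, r, rfl⟩ := p.split
  · have hsn : Z = W := by rw [← hZ, ← q.eq_of_le le_rfl, ht n (by omega)]
    refine ⟨?_, fun _ h => absurd (h.symm.trans hsn) hW.symm,
      fun _ h => absurd (h.symm.trans hsn) hW.symm, fun _ h => absurd (h.symm.trans hsn) hne⟩
    rintro rfl -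
    exact H.far_near hVW q (fun i hi => ht i (by omega)) hY (fun i hi => (hZ' i hi).trans hsn)
  · obtain ⟨X', Y', Z', hu, hu', hv, hv', hv'', hc⟩ := hs.cases hVW
    have hX : Z = X' := by rw [← hZ, ← q.eq_of_le le_rfl, hu]
    obtain ⟨i1, i2, i3, i4⟩ := ih b (by omega) r ht hv hv' hv''
    subst hX
    refine ⟨?_, ?_, ?_, ?_⟩ <;> rintro rfl rfl
    · obtain ⟨h1, h2, h3⟩ | ⟨h1, h2, h3⟩ | ⟨h1, h2, h3⟩ | ⟨h1, h2, h3⟩ := hc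
      · exact absurd h1.symm hne
      · exact absurd h1 hW
      · exact absurd h1 hW
      · have := i2 h2 h3
        omega
    · obtain ⟨h1, h2, h3⟩ | ⟨h1, h2, h3⟩ | ⟨h1, h2, h3⟩ | ⟨h1, h2, h3⟩ := hc
      · exact absurd h1.symm hV
      · have := i4 h2 h3
        have := H.far_mid hVW q (fun i hi => (hu' i hi).trans h2) hY hZ'
        omega
      · have := i1 h2 h3
        have := H.near_mid hVW.symm q (fun i hi => (hu' i hi).trans h2) hY hZ'
        omega
      · exact absurd h1.symm hW
    · obtain ⟨h1, h2, h3⟩ | ⟨h1, h2, h3⟩ | ⟨h1, h2, h3⟩ | ⟨h1, h2, h3⟩ := hc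
      · exact absurd h1.symm hV
      · have := i4 h2 h3
        omega
      · have := i1 h2 h3
        have := H.far_mid hVW.symm q (fun i hi => (hu' i hi).trans h2) hY hZ'
        omega
      · exact absurd h1.symm hW
    · obtain ⟨h1, h2, h3⟩ | ⟨h1, h2, h3⟩ | ⟨h1, h2, h3⟩ | ⟨h1, h2, h3⟩ := hc
      · have := i3 h2 h3
        omega
      · exact absurd h1 hV
      · exact absurd h1 hV
      · exact absurd h1 hne

lemma GatherBounds.succ {n : ℕ} (hn : 1 ≤ n) (H : GatherBounds n) : GatherBounds (n + 1) := by
  have hrec := optLength_succ hn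
  have hrec' : optLength n ≤ 3 + optLength (n - 1) + optLength (n - 2) + optLength (n - 3) := by
    obtain rfl | h := hn.eq_or_lt
    · simp [optLength]
    · obtain ⟨k, rfl⟩ := Nat.exists_eq_add_of_le' hn
      have := optLength_succ (n := k) (by omega)
      simp only [Nat.add_sub_cancel, show k + 1 - 2 = k - 1 by omega,
        show k + 1 - 3 = k - 2 by omega]
      omega
  have hm1 : optLength (n - 1) ≤ optLength n := optLength_mono (by omega)
  have hm2 : optLength (n - 2) ≤ optLength n := optLength_mono (by omega)
  constructor
  all_goals
    intro V W hVW m s t p ht hs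
    obtain ⟨hne, hV, hW⟩ := hVW.ne
    try intro hs'
    try simp only [Nat.add_sub_cancel, show n + 1 - 2 = n - 1 by omega,
        show n + 1 - 3 = n - 2 by omega]
    obtain q | ⟨a, b, u, v, q, hstep, r, rfl⟩ := p.split
  all_goals have hn' := q.eq_of_le le_rfl
  · rw [ht n (by omega), hs n (by omega)] at hn'
    exact absurd hn'.symm hne
  · obtain ⟨X, Y, Z, hu, hu', hv, hv', hv'', hc⟩ := hstep.cases hVW
    obtain ⟨i1, i2, i3, i4⟩ := H.after_move hn hVW b r ht hv hv' hv''
    rw [hu, hs n (by omega)] at hn'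
    obtain ⟨h1, h2, h3⟩ | ⟨h1, h2, h3⟩ | ⟨h1, h2, h3⟩ | ⟨h1, h2, h3⟩ := hc
    · have := H.far_far hVW q (fun i hi => (hu' i hi).trans h2) (fun i hi => hs i (by omega))
      have := i3 h2 h3
      omega
    · exact absurd (hn'.symm.trans h1) hV
    · exact absurd (hn'.symm.trans h1) hV
    · exact absurd (hn'.symm.trans h1) hne
  · exact H.far_far hVW q (fun i hi => ht i (by omega)) (fun i hi => hs i (by omega))
  · obtain ⟨X, Y, Z, hu, hu', hv, hv', hv'', hc⟩ := hstep.cases hVW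
    obtain ⟨i1, i2, i3, i4⟩ := H.after_move hn hVW b r ht hv hv' hv''
    rw [hu, hs' n rfl] at hn'
    obtain ⟨h1, h2, h3⟩ | ⟨h1, h2, h3⟩ | ⟨h1, h2, h3⟩ | ⟨h1, h2, h3⟩ := hc
    · exact absurd (hn'.symm.trans h1) hne.symm
    · exact absurd (hn'.symm.trans h1) hW
    · exact absurd (hn'.symm.trans h1) hW
    · have := i2 h2 h3
      omega
  · rw [ht n (by omega), hs' n rfl] at hn'
    exact absurd hn' hW
  · obtain ⟨X, Y, Z, hu, hu', hv, hv', hv'', hc⟩ := hstep.cases hVW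
    obtain ⟨i1, i2, i3, i4⟩ := H.after_move hn hVW b r ht hv hv' hv''
    rw [hu, hs' n rfl] at hn'
    obtain ⟨h1, h2, h3⟩ | ⟨h1, h2, h3⟩ | ⟨h1, h2, h3⟩ | ⟨h1, h2, h3⟩ := hc
    · exact absurd (hn'.symm.trans h1) hV.symm
    · have := i4 h2 h3
      omega
    · have := i1 h2 h3
      omega
    · exact absurd (hn'.symm.trans h1) hW.symm
  · rw [ht n (by omega), hs' n rfl] at hn'
    exact absurd hn' hW
  · obtain ⟨X, Y, Z, hu, hu', hv, hv', hv'', hc⟩ := hstep.cases hVW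
    obtain ⟨i1, i2, i3, i4⟩ := H.after_move hn hVW b r ht hv hv' hv''
    rw [hu, hs' n rfl] at hn'
    obtain ⟨h1, h2, h3⟩ | ⟨h1, h2, h3⟩ | ⟨h1, h2, h3⟩ | ⟨h1, h2, h3⟩ := hc
    · exact absurd (hn'.symm.trans h1) hV.symm
    · have := i4 h2 h3
      omega
    · have := H.far_far hVW.symm q (fun i hi => (hu' i hi).trans h2) (fun i hi => hs i (by omega))
      have := i1 h2 h3
      omega
    · exact absurd (hn'.symm.trans h1) hW.symm

lemma gatherBounds_one : GatherBounds 1 := by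
  have key : ∀ {m : ℕ} {s t : ℕ → Fin 3}, FibPath_s17 1 m s t →
      ((t 0 : ℕ) ≤ s 0 + m ∧ (s 0 : ℕ) ≤ t 0 + m) := by
    intro m s t p
    induction p with
    | nil => simp
    | cons hd h _ ih =>
      obtain rfl : _ = 0 := Nat.lt_one_iff.mp hd
      obtain ⟨X, Y, Z, -, -, -, h1, h2, -, h3, -⟩ := h
      rw [h3] at ih
      rw [h2]
      have := X.isLt
      have := Z.isLt
      obtain rfl | rfl := h1 <;> simp at * <;> omega
  constructor
  all_goals
    intro V W hVW m s t p ht hs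
    try intro hs'
    have := key p
    obtain ⟨rfl, rfl⟩ | ⟨rfl, rfl⟩ := hVW <;> simp_all [optLength] <;> omega

lemma gatherBounds_of_pos {n : ℕ} (hn : 1 ≤ n) : GatherBounds n := by
  induction n, hn using Nat.le_induction with
  | base => exact gatherBounds_one
  | succ n hn ih => exact ih.succ hn

lemma optLength_le {n m : ℕ} {s t : ℕ → Fin 3} (p : FibPath_s17 n m s t) (hs : ∀ i < n, s i = 0)
    (ht : ∀ i < n, t i = 2) : optLength n ≤ m := by
  obtain rfl | hn := Nat.eq_zero_or_pos n
  · simp [optLength]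
  · exact (gatherBounds_of_pos hn).far_far (.inl ⟨rfl, rfl⟩) p ht hs

lemma FibStep.linFibMove {n d : ℕ} (hd : d < n) {s t : ℕ → Fin 3} (h : FibStep d s t) :
    LinFibMove n (d + 1) (fun i => s i) (fun i => t i) := by
  obtain ⟨X, Y, Z, h1, h2, h3, h4, h5, h6, h7, h8, h9⟩ := h
  refine ⟨by omega, by omega, X, Y, Z, h1, h2, h3, ?_, ?_, ?_, ?_, ?_, ?_⟩
  · clear h5 h6 h7 h8 h9
    revert X Y Z; decide
  all_goals grind

lemma LinFibMove.fibStep {n k : ℕ} {s t : Fin n → Fin 3} (h : LinFibMove n k s t) :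
    FibStep (k - 1) (fun i => if h : i < n then s ⟨i, h⟩ else 0)
      (fun i => if h : i < n then t ⟨i, h⟩ else 0) := by
  obtain ⟨hk, hkn, X, Y, Z, h1, h2, h3, h4, h5, -, h6, h7, h8⟩ := h
  refine ⟨X, Y, Z, h1, h2, h3, ?_, ?_, ?_, ?_, ?_, ?_⟩
  · clear h5 h6 h7 h8
    revert X Y Z; decide
  all_goals grind

lemma FibPath_s17.exists_seq {n m : ℕ} {s t : ℕ → Fin 3} (p : FibPath_s17 n m s t) :
    ∃ f : ℕ → Fin n → Fin 3, (f 0 = fun i : Fin n => s i) ∧ (f m = fun i : Fin n => t i) ∧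
      ∀ i < m, ∃ k, LinFibMove n k (f i) (f (i + 1)) := by
  induction p with
  | nil s => exact ⟨fun _ i => s i, rfl, rfl, by simp⟩
  | @cons d m s u t hd h _ ih =>
    obtain ⟨f, h0, hm, hf⟩ := ih
    refine ⟨fun j => Nat.casesOn j (fun i => s i) f, rfl, hm, fun i hi => ?_⟩
    obtain _ | i := i
    · refine ⟨d + 1, ?_⟩
      simpa [h0] using h.linFibMove hd
    · exact hf i (by omega)

lemma exists_isLinSolution (n : ℕ) : ∃ s, IsLinSolution n (optLength n) s := by
  obtain ⟨t, p, ht⟩ := exists_fibPath n (V := 0) (W := 2) (.inl ⟨rfl, rfl⟩) (fun _ => 0) (by simp)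
  obtain ⟨f, h0, hm, hf⟩ := p.exists_seq
  exact ⟨f, h0, hm.trans (funext fun i => ht i i.2), hf⟩

lemma IsLinSolution.optLength_le {n m : ℕ} {s : ℕ → Fin n → Fin 3} (h : IsLinSolution n m s) :
    optLength n ≤ m := by
  obtain ⟨h0, hm, h⟩ := h
  have key : ∀ j ≤ m, FibPath_s17 n j (fun i => if h : i < n then s 0 ⟨i, h⟩ else 0)
      (fun i => if h : i < n then s j ⟨i, h⟩ else 0) := by
    intro j hj
    induction j with
    | zero => exact .nil _
    | succ j ih =>
      obtain ⟨k, hk⟩ := h j (by omega)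
      have := hk.1
      have := hk.2.1
      exact (ih (by omega)).trans (.single (by omega) hk.fibStep)
  refine _root_.optLength_le (key m le_rfl) ?_ ?_ <;> intro i hi <;> simp [hi, h0, hm]

/-- The linear Tower of Hanoi-Fibonacci with `n` disks is solvable
for every `n ≥ 0`, and the minimal number `M n` of permitted moves needed to go from
the state with all disks on peg `A` to the state with all disks on peg `C` satisfies
`M 0 = 0`, `M 1 = 2`, `M 2 = 5`, and `M n = M (n-1) + M (n-2) + M (n-3) + 3` for every
`n ≥ 3`. -/
theorem linearHanoiFibonacci_optimal :
    (∀ n : ℕ, ∃ m s, IsLinSolution n m s) ∧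
    ∀ M : ℕ → ℕ,
      (∀ n, (∃ s, IsLinSolution n (M n) s) ∧ ∀ m s, IsLinSolution n m s → M n ≤ m) →
      M 0 = 0 ∧ M 1 = 2 ∧ M 2 = 5 ∧
        ∀ n, 3 ≤ n → M n = M (n - 1) + M (n - 2) + M (n - 3) + 3 := by
  refine ⟨fun n => ⟨_, exists_isLinSolution n⟩, fun M hM => ?_⟩
  have hM' : M = optLength := by
    funext n
    obtain ⟨⟨s, hs⟩, hmin⟩ := hM n
    obtain ⟨s', hs'⟩ := exists_isLinSolution n
    exact le_antisymm (hmin _ _ hs') hs.optLength_le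
  subst hM'
  refine ⟨rfl, rfl, rfl, fun n hn => ?_⟩
  obtain ⟨k, rfl⟩ := Nat.exists_eq_add_of_le' hn
  rfl
end
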